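/- For the cost function c(x,y) = −√(1−|x−y|²), defined for |x−y| < 1: (i) the unique solution y of c_x(x,y) = p is Y(x,p) = x − p/√(1+|p|²), and the matrix A(x,p) = c_{xx}(x,Y(x,p)) equals A(p) = (1+|p|²)^{1/2}(I + p⊗p); (ii) c satisfies condition (A3): for every R > 0 there is δ > 0 such that Σ D_{p_kp_l}A_{ij}(p) ξ_iξ_jη_kη_l ≥ δ|ξ|²|η|² for all |p| ≤ R and all ξ, η ∈ ℝⁿ with ξ ⊥ η. -/

import Mathlib

noncomputable section

variable {n : ℕ}

/-- Partial derivative in the `i`-th coordinate direction. -/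
def pd (i : Fin n) (f : (Fin n → ℝ) → ℝ) (x : Fin n → ℝ) : ℝ :=
  fderiv ℝ f x (Pi.single i 1)

/-- Gradient vector. -/
def gradv (f : (Fin n → ℝ) → ℝ) (x : Fin n → ℝ) : Fin n → ℝ :=
  fun i => pd i f x

/-- Hessian matrix `D²f`. -/
def hessM (f : (Fin n → ℝ) → ℝ) (x : Fin n → ℝ) : Matrix (Fin n) (Fin n) ℝ :=
  Matrix.of fun i j => pd i (fun z => pd j f z) x

/-- `c_x(x,y)`. -/
def cxV (c : (Fin n → ℝ) → (Fin n → ℝ) → ℝ) (x y : Fin n → ℝ) : Fin n → ℝ :=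
  gradv (fun z => c z y) x

/-- `c_y(x,y)`. -/
def cyV (c : (Fin n → ℝ) → (Fin n → ℝ) → ℝ) (x y : Fin n → ℝ) : Fin n → ℝ :=
  gradv (fun z => c x z) y

/-- `c_{xx}(x,y)`. -/
def cxxM (c : (Fin n → ℝ) → (Fin n → ℝ) → ℝ) (x y : Fin n → ℝ) :
    Matrix (Fin n) (Fin n) ℝ :=
  hessM (fun z => c z y) x

/-- The matrix `c_{x,y} = [∂²c/∂x_i∂y_j]`. -/
def cxyM (c : (Fin n → ℝ) → (Fin n → ℝ) → ℝ) (x y : Fin n → ℝ) :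
    Matrix (Fin n) (Fin n) ℝ :=
  Matrix.of fun i j => pd j (fun z => pd i (fun w => c w z) x) y

/-- Third derivatives `c_{ij,l} = ∂³c/∂x_i∂x_j∂y_l`. -/
def cxxyD (c : (Fin n → ℝ) → (Fin n → ℝ) → ℝ) (i j l : Fin n) (x y : Fin n → ℝ) : ℝ :=
  pd l (fun z => cxxM c x z i j) y

/-- The mapping `Tu = Y(·, Du)`. -/
def Tmap (Y : (Fin n → ℝ) → (Fin n → ℝ) → (Fin n → ℝ)) (u : (Fin n → ℝ) → ℝ)
    (x : Fin n → ℝ) : Fin n → ℝ :=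
  Y x (gradv u x)

/-- The matrix `w = D²u − c_{xx}(·, Tu)`. -/
def wMat (c : (Fin n → ℝ) → (Fin n → ℝ) → ℝ)
    (Y : (Fin n → ℝ) → (Fin n → ℝ) → (Fin n → ℝ)) (u : (Fin n → ℝ) → ℝ)
    (x : Fin n → ℝ) : Matrix (Fin n) (Fin n) ℝ :=
  hessM u x - cxxM c x (Tmap Y u x)

/-- `A(x,p) = c_{xx}(x, Y(x,p))`. -/
def AMat (c : (Fin n → ℝ) → (Fin n → ℝ) → ℝ)
    (Y : (Fin n → ℝ) → (Fin n → ℝ) → (Fin n → ℝ)) (x p : Fin n → ℝ) :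
    Matrix (Fin n) (Fin n) ℝ :=
  cxxM c x (Y x p)

/-- `D_{p_k p_l} A_{ij}(x,p)`. -/
def D2pA (c : (Fin n → ℝ) → (Fin n → ℝ) → ℝ)
    (Y : (Fin n → ℝ) → (Fin n → ℝ) → (Fin n → ℝ)) (i j k l : Fin n)
    (x p : Fin n → ℝ) : ℝ :=
  pd k (fun q => pd l (fun r => AMat c Y x r i j) q) p

/-- Condition (A1): unique solvability of `c_x(x,·) = p` and `c_y(·,y) = q`,
with `Y` the solution map of the first. -/
def CondA1 (c : (Fin n → ℝ) → (Fin n → ℝ) → ℝ)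
    (Y : (Fin n → ℝ) → (Fin n → ℝ) → (Fin n → ℝ)) : Prop :=
  (∀ x p : Fin n → ℝ, ∃! y, cxV c x y = p) ∧
  (∀ y q : Fin n → ℝ, ∃! x, cyV c x y = q) ∧
  (∀ x p : Fin n → ℝ, cxV c x (Y x p) = p)

/-- Condition (A2). -/
def CondA2 (c : (Fin n → ℝ) → (Fin n → ℝ) → ℝ) (Ω Ω' : Set (Fin n → ℝ)) : Prop :=
  ∀ x ∈ closure Ω, ∀ y ∈ closure Ω', (cxyM c x y).det ≠ 0

/-- Condition (A3w). -/
def CondA3w (c : (Fin n → ℝ) → (Fin n → ℝ) → ℝ)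
    (Y : (Fin n → ℝ) → (Fin n → ℝ) → (Fin n → ℝ)) (Ω : Set (Fin n → ℝ)) : Prop :=
  ∀ x ∈ Ω, ∀ p ξ η : Fin n → ℝ, (∑ i, ξ i * η i) = 0 →
    0 ≤ ∑ i, ∑ j, ∑ k, ∑ l, D2pA c Y i j k l x p * ξ i * ξ j * η k * η l

/-- Unit outer normal field obtained from a defining function. -/
def nml (φ : (Fin n → ℝ) → ℝ) (x : Fin n → ℝ) : Fin n → ℝ :=
  (Real.sqrt (∑ i, gradv φ x i ^ 2))⁻¹ • gradv φ x

/-- `φ` is a `C^k` defining function for `Ω`. -/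
def DefiningFn (Ω : Set (Fin n → ℝ)) (φ : (Fin n → ℝ) → ℝ) (k : ℕ) : Prop :=
  ContDiff ℝ (k : ℕ∞) φ ∧ (∀ x, x ∈ Ω ↔ φ x < 0) ∧
  (∀ x ∈ frontier Ω, φ x = 0) ∧ (∀ x ∈ frontier Ω, gradv φ x ≠ 0)

/-- The uniform c-convexity inequality (1.20) with constant `δ₀`,
expressed via the defining function `φ` of `Ω`. -/
def UnifCConvexWith (δ₀ : ℝ) (c : (Fin n → ℝ) → (Fin n → ℝ) → ℝ)
    (Ω Ω' : Set (Fin n → ℝ)) (φ : (Fin n → ℝ) → ℝ) : Prop :=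
  ∀ x ∈ frontier Ω, ∀ y ∈ Ω', ∀ τ : Fin n → ℝ,
    (∑ i, τ i ^ 2) = 1 → (∑ i, τ i * nml φ x i) = 0 →
    δ₀ ≤ ∑ i, ∑ j,
      (pd i (fun z => nml φ z j) x
        - ∑ l, ∑ k, (cxyM c x y)⁻¹ l k * cxxyD c i j l x y * nml φ x k) * τ i * τ j

/-- `Ω` is uniformly c-convex with respect to `Ω'` (via the defining function `φ`). -/
def UnifCConvex (c : (Fin n → ℝ) → (Fin n → ℝ) → ℝ) (Ω Ω' : Set (Fin n → ℝ))
    (φ : (Fin n → ℝ) → ℝ) : Prop :=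
  ∃ δ₀ > (0:ℝ), UnifCConvexWith δ₀ c Ω Ω' φ

/-- The swapped cost `c*(x,y) = c(y,x)`. -/
def cswap (c : (Fin n → ℝ) → (Fin n → ℝ) → ℝ) : (Fin n → ℝ) → (Fin n → ℝ) → ℝ :=
  fun x y => c y x

/-- Ellipticity: `w = D²u − c_{xx}(·,Tu)` is positive definite on `S`. -/
def Elliptic (c : (Fin n → ℝ) → (Fin n → ℝ) → ℝ)
    (Y : (Fin n → ℝ) → (Fin n → ℝ) → (Fin n → ℝ)) (u : (Fin n → ℝ) → ℝ)
    (S : Set (Fin n → ℝ)) : Prop :=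
  ∀ x ∈ S, (wMat c Y u x).PosDef

/-- The Monge–Ampère equation (1.14) with right hand side `|det c_{x,y}| ψ`. -/
def MAeq (c : (Fin n → ℝ) → (Fin n → ℝ) → ℝ)
    (Y : (Fin n → ℝ) → (Fin n → ℝ) → (Fin n → ℝ)) (u : (Fin n → ℝ) → ℝ)
    (ψ : (Fin n → ℝ) → ℝ → (Fin n → ℝ) → ℝ) (Ω : Set (Fin n → ℝ)) : Prop :=
  ∀ x ∈ Ω, (wMat c Y u x).det = |(cxyM c x (Tmap Y u x)).det| * ψ x (u x) (gradv u x)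

/-- `u ∈ C^k(Ω̄)`: `u` is `C^k` on an open neighbourhood of the closure of `Ω`. -/
def CkOnClosure (k : ℕ∞) (u : (Fin n → ℝ) → ℝ) (Ω : Set (Fin n → ℝ)) : Prop :=
  ∃ U, IsOpen U ∧ closure Ω ⊆ U ∧ ContDiffOn ℝ k u U

/-- Example 2: the cost function `c(x,y) = −√(1−|x−y|²)`, defined for `|x−y| < 1`. -/
def c17 : (Fin n → ℝ) → (Fin n → ℝ) → ℝ :=
  fun x y => -Real.sqrt (1 - ∑ i, (x i - y i) ^ 2)

/-- The corresponding map `Y(x,p) = x − p/√(1+|p|²)`. -/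
def Y17 : (Fin n → ℝ) → (Fin n → ℝ) → (Fin n → ℝ) :=
  fun x p => x - (Real.sqrt (1 + ∑ i, p i ^ 2))⁻¹ • p

section PartialDerivatives

variable {f g : (Fin n → ℝ) → ℝ} {x : Fin n → ℝ}

lemma pd_eq_of_hasFDerivAt {f' : (Fin n → ℝ) →L[ℝ] ℝ} (h : HasFDerivAt f f' x) (i : Fin n) :
    pd i f x = f' (Pi.single i 1) := by
  rw [pd, h.fderiv]

lemma pd_congr (h : f =ᶠ[nhds x] g) (i : Fin n) : pd i f x = pd i g x := by
  rw [pd, pd, h.fderiv_eq]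

lemma pd_add (hf : DifferentiableAt ℝ f x) (hg : DifferentiableAt ℝ g x) (i : Fin n) :
    pd i (fun z => f z + g z) x = pd i f x + pd i g x := by
  rw [pd_eq_of_hasFDerivAt (hf.hasFDerivAt.fun_add hg.hasFDerivAt)]
  rfl

lemma pd_mul (hf : DifferentiableAt ℝ f x) (hg : DifferentiableAt ℝ g x) (i : Fin n) :
    pd i (fun z => f z * g z) x = f x * pd i g x + g x * pd i f x := by
  rw [pd_eq_of_hasFDerivAt (hf.hasFDerivAt.fun_mul hg.hasFDerivAt)]
  rfl

lemma pd_const (a : ℝ) (i : Fin n) : pd i (fun _ => a) x = 0 := by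
  simp [pd]

lemma pd_const_add (a : ℝ) (i : Fin n) : pd i (fun z => a + f z) x = pd i f x := by
  rw [pd, pd, fderiv_const_add]

lemma pd_comp {φ : ℝ → ℝ} {φ' : ℝ} (hφ : HasDerivAt φ φ' (f x)) (hf : DifferentiableAt ℝ f x)
    (i : Fin n) : pd i (fun z => φ (f z)) x = φ' * pd i f x := by
  have h : HasFDerivAt (fun z => φ (f z)) (φ' • fderiv ℝ f x) x :=
    hφ.comp_hasFDerivAt x hf.hasFDerivAt
  rw [pd_eq_of_hasFDerivAt h]
  rfl

lemma pd_coord_sub (i j : Fin n) (a : ℝ) :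
    pd i (fun z => z j - a) x = if i = j then 1 else 0 := by
  rw [pd_eq_of_hasFDerivAt ((hasFDerivAt_apply j x).sub_const a)]
  simp [Pi.single_apply, eq_comm]

lemma pd_coord (i j : Fin n) : pd i (fun z => z j) x = if i = j then 1 else 0 := by
  simpa using pd_coord_sub (x := x) i j 0

lemma pd_sum_sq_sub (y : Fin n → ℝ) (i : Fin n) :
    pd i (fun z => ∑ j, (z j - y j) ^ 2) x = 2 * (x i - y i) := by
  rw [pd_eq_of_hasFDerivAt
    (HasFDerivAt.fun_sum fun j _ => ((hasFDerivAt_apply j x).sub_const (y j)).pow 2)]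
  simp [Pi.single_apply]

lemma pd_sum_sq (i : Fin n) : pd i (fun z => ∑ j, z j ^ 2) x = 2 * x i := by
  simpa using pd_sum_sq_sub (x := x) 0 i

end PartialDerivatives

section Cost

variable {x y : Fin n → ℝ}

lemma cxV_c17 (h : ∑ i, (x i - y i) ^ 2 < 1) (i : Fin n) :
    cxV c17 x y i = (x i - y i) * (Real.sqrt (1 - ∑ k, (x k - y k) ^ 2))⁻¹ := by
  have hφ : HasDerivAt (fun t : ℝ => -Real.sqrt (1 - t))
      (-(-1 / (2 * Real.sqrt (1 - ∑ k, (x k - y k) ^ 2)))) (∑ k, (x k - y k) ^ 2) :=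
    (((hasDerivAt_id _).const_sub 1).sqrt (sub_pos.2 h).ne').neg
  change pd i (fun z => -Real.sqrt (1 - ∑ k, (z k - y k) ^ 2)) x = _
  rw [pd_comp (f := fun z => ∑ k, (z k - y k) ^ 2) hφ (by fun_prop), pd_sum_sq_sub]
  have := Real.sqrt_pos.2 (sub_pos.2 h)
  field_simp

lemma cxxM_c17 (h : ∑ i, (x i - y i) ^ 2 < 1) (i j : Fin n) :
    cxxM c17 x y i j =
      (if i = j then 1 else 0) * (Real.sqrt (1 - ∑ k, (x k - y k) ^ 2))⁻¹ +
        (x i - y i) * (x j - y j) * (Real.sqrt (1 - ∑ k, (x k - y k) ^ 2))⁻¹ ^ 3 := by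
  have hs := Real.sqrt_pos.2 (sub_pos.2 h)
  have hφ : HasDerivAt (fun t : ℝ => (Real.sqrt (1 - t))⁻¹) _ (∑ k, (x k - y k) ^ 2) :=
    (((hasDerivAt_id _).const_sub 1).sqrt (sub_pos.2 h).ne').inv hs.ne'
  have hf : DifferentiableAt ℝ (fun z : Fin n → ℝ => ∑ k, (z k - y k) ^ 2) x := by fun_prop
  have hopen : ∀ᶠ z in nhds x, ∑ k, (z k - y k) ^ 2 < 1 :=
    hf.continuousAt.eventually_lt continuousAt_const h
  have hw : DifferentiableAt ℝ (fun z => (Real.sqrt (1 - ∑ k, (z k - y k) ^ 2))⁻¹) x :=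
    (hf.const_sub 1).sqrt (sub_pos.2 h).ne' |>.inv hs.ne'
  change pd i (fun z => cxV c17 z y j) x = _
  rw [pd_congr (hopen.mono fun z hz => cxV_c17 hz j),
    pd_mul (by fun_prop) hw,
    pd_comp (f := fun z => ∑ k, (z k - y k) ^ 2) hφ hf, pd_sum_sq_sub,
    pd_coord_sub]
  field_simp
  ring

end Cost

section Matrix

/-- The function `√(1+|p|²)`. -/
def sqrtOneAdd (p : Fin n → ℝ) : ℝ := Real.sqrt (1 + ∑ k, p k ^ 2)

variable (x p : Fin n → ℝ)

lemma one_add_sum_sq_pos : 0 < 1 + ∑ k, p k ^ 2 := by positivity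

lemma sqrtOneAdd_pos : 0 < sqrtOneAdd p := Real.sqrt_pos.2 (one_add_sum_sq_pos p)

lemma sq_sqrtOneAdd : sqrtOneAdd p ^ 2 = 1 + ∑ k, p k ^ 2 :=
  Real.sq_sqrt (one_add_sum_sq_pos p).le

lemma differentiable_sqrtOneAdd : Differentiable ℝ (sqrtOneAdd (n := n)) := fun p =>
  DifferentiableAt.sqrt (by fun_prop) (one_add_sum_sq_pos p).ne'

lemma differentiable_inv_sqrtOneAdd : Differentiable ℝ fun q : Fin n → ℝ => (sqrtOneAdd q)⁻¹ :=
  fun p => (differentiable_sqrtOneAdd p).inv (sqrtOneAdd_pos p).ne'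

lemma pd_sqrtOneAdd (i : Fin n) : pd i sqrtOneAdd p = p i * (sqrtOneAdd p)⁻¹ := by
  have hφ : HasDerivAt (fun t : ℝ => Real.sqrt (1 + t)) (1 / (2 * sqrtOneAdd p))
      (∑ k, p k ^ 2) :=
    ((hasDerivAt_id _).const_add 1).sqrt (one_add_sum_sq_pos p).ne'
  change pd i (fun z => Real.sqrt (1 + ∑ k, z k ^ 2)) p = _
  rw [pd_comp (f := fun z => ∑ k, z k ^ 2) hφ (by fun_prop), pd_sum_sq]
  have := sqrtOneAdd_pos p
  field_simp

lemma pd_inv_sqrtOneAdd (i : Fin n) :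
    pd i (fun q => (sqrtOneAdd q)⁻¹) p = -(p i * (sqrtOneAdd p)⁻¹ ^ 3) := by
  have hs := sqrtOneAdd_pos p
  rw [pd_comp (hasDerivAt_inv hs.ne') (differentiable_sqrtOneAdd p), pd_sqrtOneAdd]
  field_simp

lemma sub_Y17 (i : Fin n) : x i - Y17 x p i = p i * (sqrtOneAdd p)⁻¹ := by
  simp [Y17, sqrtOneAdd, mul_comm]

lemma one_sub_sum_sq_sub_Y17 :
    1 - ∑ i, (x i - Y17 x p i) ^ 2 = (sqrtOneAdd p)⁻¹ ^ 2 := by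
  have hs := sqrtOneAdd_pos p
  simp only [sub_Y17, mul_pow, ← Finset.sum_mul]
  field_simp
  linarith [sq_sqrtOneAdd p]

lemma sum_sq_sub_Y17_lt_one : ∑ i, (x i - Y17 x p i) ^ 2 < 1 := by
  have hs := sqrtOneAdd_pos p
  have : 0 < (sqrtOneAdd p)⁻¹ ^ 2 := by positivity
  linarith [one_sub_sum_sq_sub_Y17 x p]

lemma inv_sqrt_one_sub_sum_sq_sub_Y17 :
    (Real.sqrt (1 - ∑ i, (x i - Y17 x p i) ^ 2))⁻¹ = sqrtOneAdd p := by
  rw [one_sub_sum_sq_sub_Y17, Real.sqrt_sq (inv_pos.2 (sqrtOneAdd_pos p)).le, inv_inv]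

lemma cxV_c17_Y17 : cxV c17 x (Y17 x p) = p := by
  ext i
  rw [cxV_c17 (sum_sq_sub_Y17_lt_one x p), inv_sqrt_one_sub_sum_sq_sub_Y17, sub_Y17,
    inv_mul_cancel_right₀ (sqrtOneAdd_pos p).ne']

lemma eq_Y17_of_cxV_c17_eq {x p y : Fin n → ℝ} (hy : ∑ i, (x i - y i) ^ 2 < 1)
    (h : cxV c17 x y = p) : y = Y17 x p := by
  have hw := Real.sqrt_pos.2 (sub_pos.2 hy)
  have hsq := Real.sq_sqrt (sub_pos.2 hy).le
  set w := Real.sqrt (1 - ∑ i, (x i - y i) ^ 2)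
  have hp (i : Fin n) : p i = (x i - y i) * w⁻¹ := by rw [← h, cxV_c17 hy]
  have hs : sqrtOneAdd p = w⁻¹ := by
    rw [← sq_eq_sq₀ (sqrtOneAdd_pos p).le (inv_pos.2 hw).le, sq_sqrtOneAdd]
    simp only [hp, mul_pow, ← Finset.sum_mul]
    field_simp
    linarith
  ext i
  have := sub_Y17 x p i
  rw [hs, inv_inv, hp, inv_mul_cancel_right₀ hw.ne'] at this
  linarith

lemma cxxM_c17_Y17 (i j : Fin n) :
    cxxM c17 x (Y17 x p) i j = sqrtOneAdd p * ((if i = j then 1 else 0) + p i * p j) := by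
  have := sqrtOneAdd_pos p
  rw [cxxM_c17 (sum_sq_sub_Y17_lt_one x p), inv_sqrt_one_sub_sum_sq_sub_Y17, sub_Y17, sub_Y17]
  field_simp

lemma pd_AMat_c17 (i j l : Fin n) :
    pd l (fun r => AMat c17 Y17 x r i j) p =
      sqrtOneAdd p * (p i * (if l = j then 1 else 0) + p j * (if l = i then 1 else 0)) +
        (sqrtOneAdd p)⁻¹ * (p l * ((if i = j then 1 else 0) + p i * p j)) := by
  have hs := differentiable_sqrtOneAdd p
  simp only [AMat, cxxM_c17_Y17]
  rw [pd_mul hs (by fun_prop), pd_const_add, pd_mul (by fun_prop) (by fun_prop), pd_coord,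
    pd_coord, pd_sqrtOneAdd]
  ring

lemma D2pA_c17 (i j k l : Fin n) :
    D2pA c17 Y17 i j k l x p =
      sqrtOneAdd p * ((if k = i then 1 else 0) * (if l = j then 1 else 0) +
          (if k = j then 1 else 0) * (if l = i then 1 else 0)) +
        (sqrtOneAdd p)⁻¹ * (p k *
            (p i * (if l = j then 1 else 0) + p j * (if l = i then 1 else 0)) +
          p l * (p i * (if k = j then 1 else 0) + p j * (if k = i then 1 else 0)) +
          (if k = l then 1 else 0) * ((if i = j then 1 else 0) + p i * p j)) -
        (sqrtOneAdd p)⁻¹ ^ 3 * (p k * p l * ((if i = j then 1 else 0) + p i * p j)) := by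
  have hs := differentiable_sqrtOneAdd p
  have hs' := differentiable_inv_sqrtOneAdd p
  simp only [D2pA, pd_AMat_c17]
  rw [pd_add (by fun_prop) (by fun_prop), pd_mul hs (by fun_prop), pd_mul hs' (by fun_prop),
    pd_add (by fun_prop) (by fun_prop), pd_mul (by fun_prop) (by fun_prop),
    pd_mul (by fun_prop) (by fun_prop), pd_mul (by fun_prop) (by fun_prop), pd_const_add,
    pd_mul (by fun_prop) (by fun_prop), pd_sqrtOneAdd, pd_inv_sqrtOneAdd]
  simp only [pd_coord, pd_const]
  ring

lemma sum_boole_eq_mul (f : Fin n → ℝ) (j : Fin n) :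
    ∑ l, (if j = l then 1 else 0) * f l = f j := by
  simp

lemma sum_boole_eq_mul' (f : Fin n → ℝ) (j : Fin n) :
    ∑ l, (if l = j then 1 else 0) * f l = f j := by
  simp

/-- Contraction of the second derivatives of `s(I + p⊗p)`, with `r` in place of `s⁻¹`. -/
lemma sum_contract {ξ η : Fin n → ℝ} (h : ∑ i, ξ i * η i = 0) (s r : ℝ) :
    ∑ i, ∑ j, ∑ k, ∑ l,
      (s * ((if k = i then 1 else 0) * (if l = j then 1 else 0) +
          (if k = j then 1 else 0) * (if l = i then 1 else 0)) +
        r * (p k * (p i * (if l = j then 1 else 0) + p j * (if l = i then 1 else 0)) +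
          p l * (p i * (if k = j then 1 else 0) + p j * (if k = i then 1 else 0)) +
          (if k = l then 1 else 0) * ((if i = j then 1 else 0) + p i * p j)) -
        r ^ 3 * (p k * p l * ((if i = j then 1 else 0) + p i * p j))) *
          ξ i * ξ j * η k * η l =
      (r * ∑ k, η k ^ 2 - r ^ 3 * (∑ k, p k * η k) ^ 2) *
        (∑ i, ξ i ^ 2 + (∑ i, p i * ξ i) ^ 2) := by
  generalize hN : ∑ k, η k ^ 2 = N
  generalize hP : ∑ k, p k * η k = P
  generalize hQ : ∑ k, p k * ξ k = Q
  have hl (i j k : Fin n) : ∑ l,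
      (s * ((if k = i then 1 else 0) * (if l = j then 1 else 0) +
          (if k = j then 1 else 0) * (if l = i then 1 else 0)) +
        r * (p k * (p i * (if l = j then 1 else 0) + p j * (if l = i then 1 else 0)) +
          p l * (p i * (if k = j then 1 else 0) + p j * (if k = i then 1 else 0)) +
          (if k = l then 1 else 0) * ((if i = j then 1 else 0) + p i * p j)) -
        r ^ 3 * (p k * p l * ((if i = j then 1 else 0) + p i * p j))) *
          ξ i * ξ j * η k * η l =
      ξ i * ξ j *
        ((s * η j + r * P * p j) * ((if k = i then 1 else 0) * η k) +
          (s * η i + r * P * p i) * ((if k = j then 1 else 0) * η k) +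
          (r * (p i * η j + p j * η i) - r ^ 3 * P * ((if i = j then 1 else 0) + p i * p j)) *
            (p k * η k) +
          r * ((if i = j then 1 else 0) + p i * p j) * η k ^ 2) := by
    trans ∑ l, ξ i * ξ j * η k *
      ((s * (if k = i then 1 else 0) + r * p k * p i) * ((if l = j then 1 else 0) * η l) +
        (s * (if k = j then 1 else 0) + r * p k * p j) * ((if l = i then 1 else 0) * η l) +
        (r * (p i * (if k = j then 1 else 0) + p j * (if k = i then 1 else 0)) -
          r ^ 3 * p k * ((if i = j then 1 else 0) + p i * p j)) * (p l * η l) +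
        r * ((if i = j then 1 else 0) + p i * p j) * ((if k = l then 1 else 0) * η l))
    · exact Finset.sum_congr rfl fun l _ => by ring
    · simp only [← Finset.mul_sum, Finset.sum_add_distrib, sum_boole_eq_mul,
        sum_boole_eq_mul', hP]
      ring
  have hk (i j : Fin n) : ∑ k, ξ i * ξ j *
        ((s * η j + r * P * p j) * ((if k = i then 1 else 0) * η k) +
          (s * η i + r * P * p i) * ((if k = j then 1 else 0) * η k) +
          (r * (p i * η j + p j * η i) - r ^ 3 * P * ((if i = j then 1 else 0) + p i * p j)) *
            (p k * η k) +
          r * ((if i = j then 1 else 0) + p i * p j) * η k ^ 2) =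
      ξ i * ((2 * s * η i + 2 * r * P * p i) * (ξ j * η j) +
        (2 * r * P * η i + (r * N - r ^ 3 * P ^ 2) * p i) * (p j * ξ j) +
        (r * N - r ^ 3 * P ^ 2) * ((if i = j then 1 else 0) * ξ j)) := by
    simp only [← Finset.mul_sum, Finset.sum_add_distrib, sum_boole_eq_mul', hP, hN]
    ring
  have hj (i : Fin n) : ∑ j, ξ i * ((2 * s * η i + 2 * r * P * p i) * (ξ j * η j) +
        (2 * r * P * η i + (r * N - r ^ 3 * P ^ 2) * p i) * (p j * ξ j) +
        (r * N - r ^ 3 * P ^ 2) * ((if i = j then 1 else 0) * ξ j)) =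
      2 * r * P * Q * (ξ i * η i) + (r * N - r ^ 3 * P ^ 2) * (Q * (p i * ξ i) + ξ i ^ 2) := by
    simp only [← Finset.mul_sum, Finset.sum_add_distrib, h, hQ,
      sum_boole_eq_mul]
    ring
  simp only [hl, hk, hj, ← Finset.mul_sum, Finset.sum_add_distrib, h, hQ]
  ring

lemma sum_D2pA_c17 {ξ η : Fin n → ℝ} (h : ∑ i, ξ i * η i = 0) :
    ∑ i, ∑ j, ∑ k, ∑ l, D2pA c17 Y17 i j k l x p * ξ i * ξ j * η k * η l =
      ((sqrtOneAdd p)⁻¹ * ∑ k, η k ^ 2 - (sqrtOneAdd p)⁻¹ ^ 3 * (∑ k, p k * η k) ^ 2) *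
        (∑ i, ξ i ^ 2 + (∑ i, p i * ξ i) ^ 2) := by
  simp only [D2pA_c17]
  exact sum_contract p h _ _

end Matrix

lemma le_sum_D2pA_c17 (x p : Fin n → ℝ) {ξ η : Fin n → ℝ} (h : ∑ i, ξ i * η i = 0) :
    (sqrtOneAdd p)⁻¹ ^ 3 * (∑ i, ξ i ^ 2) * (∑ i, η i ^ 2) ≤
      ∑ i, ∑ j, ∑ k, ∑ l, D2pA c17 Y17 i j k l x p * ξ i * ξ j * η k * η l := by
  have hs := inv_pos.2 (sqrtOneAdd_pos p)
  have hcs : (∑ k, p k * η k) ^ 2 ≤ (∑ k, p k ^ 2) * ∑ k, η k ^ 2 :=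
    Finset.sum_mul_sq_le_sq_mul_sq _ _ _
  have hη : (sqrtOneAdd p)⁻¹ * ∑ k, η k ^ 2 =
      (sqrtOneAdd p)⁻¹ ^ 3 * ((1 + ∑ k, p k ^ 2) * ∑ k, η k ^ 2) := by
    have := sqrtOneAdd_pos p
    rw [← sq_sqrtOneAdd]
    field_simp
  have hξ : 0 ≤ ∑ i, ξ i ^ 2 := by positivity
  have hη' : 0 ≤ ∑ i, η i ^ 2 := by positivity
  rw [sum_D2pA_c17 x p h, hη, ← mul_sub, mul_right_comm, mul_assoc, mul_assoc]
  gcongr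
  · linarith
  · linarith
  · linarith [sq_nonneg (∑ i, p i * ξ i)]

/-- **Example 2**: for `c(x,y) = −√(1−|x−y|²)` the unique solution of
`c_x(x,y) = p` (among `y` with `|x−y| < 1`) is `Y(x,p) = x − p/√(1+|p|²)`,
`A(p) = (1+|p|²)^{1/2}(I + p⊗p)`, and `c` satisfies condition (A3). -/
theorem example2_cost
    {n : ℕ} :
    -- (i) Y and A are as stated
    (∀ x p : Fin n → ℝ,
      (cxV c17 x (Y17 x p) = p ∧
        ∀ y : Fin n → ℝ, (∑ i, (x i - y i) ^ 2) < 1 → cxV c17 x y = p →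
          y = Y17 x p) ∧
      (∀ i j, cxxM c17 x (Y17 x p) i j =
        Real.sqrt (1 + ∑ k, p k ^ 2) * ((if i = j then (1:ℝ) else 0) + p i * p j))) ∧
    -- (ii) condition (A3) holds for |p| ≤ R
    (∀ R : ℝ, 0 < R →
      ∃ δ > (0:ℝ), ∀ x p : Fin n → ℝ, (∑ i, p i ^ 2) ≤ R ^ 2 →
        ∀ ξ η : Fin n → ℝ, (∑ i, ξ i * η i) = 0 →
          δ * (∑ i, ξ i ^ 2) * (∑ i, η i ^ 2) ≤
            ∑ i, ∑ j, ∑ k, ∑ l,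
              D2pA c17 Y17 i j k l x p * ξ i * ξ j * η k * η l) := by
  refine ⟨fun x p => ⟨⟨cxV_c17_Y17 x p, fun y hy h => eq_Y17_of_cxV_c17_eq hy h⟩,
    cxxM_c17_Y17 x p⟩, fun R _ => ⟨(Real.sqrt (1 + R ^ 2))⁻¹ ^ 3, by positivity, ?_⟩⟩
  intro x p hp ξ η h
  refine le_trans ?_ (le_sum_D2pA_c17 x p h)
  have := sqrtOneAdd_pos p
  gcongr
  exact Real.sqrt_le_sqrt (by linarith)
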